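/- The Hamiltonian H is self-adjoint with respect to the weighted inner product ⟨·,·⟩_G on ℂ^V (i.e. ⟨Hψ, φ⟩_G = ⟨ψ, Hφ⟩_G for all ψ, φ ∈ ℂ^V) if and only if the reduced operator J = P ∘ H ∘ P* is self-adjoint with respect to the standard inner product on ℂ^{0,…,N}. -/

import Mathlib

noncomputable section

/-- The transversal layer `Π⁻¹(n)` as a finset. -/
def layer {V : Type} [Fintype V] {N : ℕ} (proj : V → Fin (N + 1)) (n : Fin (N + 1)) :
    Finset V :=
  Finset.univ.filter (fun x => proj x = n)

/-- The weight `μ(x) = 1/|Π⁻¹(Π x)|`. -/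
def mu {V : Type} [Fintype V] {N : ℕ} (proj : V → Fin (N + 1)) (x : V) : ℂ :=
  ((layer proj (proj x)).card : ℂ)⁻¹

/-- The weighted inner product `⟨ψ,φ⟩_G = Σ_x ψ(x) conj(φ(x)) μ(x)` on `ℂ^V`. -/
def innerG {V : Type} [Fintype V] {N : ℕ} (proj : V → Fin (N + 1)) (ψ φ : V → ℂ) : ℂ :=
  ∑ x, ψ x * (starRingEnd ℂ) (φ x) * mu proj x

/-- The standard inner product on `ℂ^{0,…,N}`. -/
def innerStd {N : ℕ} (ψ φ : Fin (N + 1) → ℂ) : ℂ :=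
  ∑ n, ψ n * (starRingEnd ℂ) (φ n)

/-- The averaging map `P : ℂ^V → ℂ^{0,…,N}`. -/
def avg {V : Type} [Fintype V] {N : ℕ} (proj : V → Fin (N + 1)) (ψ : V → ℂ) :
    Fin (N + 1) → ℂ :=
  fun n => ((layer proj n).card : ℂ)⁻¹ * ∑ x ∈ layer proj n, ψ x

/-- The map `P* : ℂ^{0,…,N} → ℂ^V`, `(P*φ)(x) = φ(Π x)`. -/
def lift {V : Type} {N : ℕ} (proj : V → Fin (N + 1)) (φ : Fin (N + 1) → ℂ) : V → ℂ :=
  fun x => φ (proj x)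

/-- `deg₊(x)`: the number of neighbors of `x` in the next layer. -/
def degPlus {V : Type} [Fintype V] {N : ℕ} (proj : V → Fin (N + 1))
    (Adj : V → V → Prop) [DecidableRel Adj] (x : V) : ℕ :=
  (Finset.univ.filter (fun y => Adj x y ∧ (proj y : ℕ) = (proj x : ℕ) + 1)).card

/-- `deg₋(x)`: the number of neighbors of `x` in the previous layer. -/
def degMinus {V : Type} [Fintype V] {N : ℕ} (proj : V → Fin (N + 1))
    (Adj : V → V → Prop) [DecidableRel Adj] (x : V) : ℕ :=
  (Finset.univ.filter (fun y => Adj x y ∧ (proj y : ℕ) + 1 = (proj x : ℕ))).card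

theorem weighted_selfAdjoint_iff {ι : Type} [Fintype ι] [DecidableEq ι]
    (A : Matrix ι ι ℂ) (w : ι → ℂ) :
    (∀ ψ χ : ι → ℂ, ∑ x, A.mulVec ψ x * (starRingEnd ℂ) (χ x) * w x =
      ∑ x, ψ x * (starRingEnd ℂ) (A.mulVec χ x) * w x) ↔
    ∀ x y, A x y * w x = (starRingEnd ℂ) (A y x) * w y := by
  constructor
  · intro h x y
    have := h (Pi.single y 1) (Pi.single x 1)
    simpa [Pi.single_apply, apply_ite, ite_mul] using this
  · intro h ψ χ
    simp only [Matrix.mulVec, dotProduct, map_sum, map_mul, Finset.sum_mul, Finset.mul_sum]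
    rw [Finset.sum_comm]
    refine Finset.sum_congr rfl fun y _ => Finset.sum_congr rfl fun x _ => ?_
    linear_combination ψ y * (starRingEnd ℂ) (χ x) * h x y

theorem conj_mu {V : Type} [Fintype V] {N : ℕ} (proj : V → Fin (N + 1)) (x : V) :
    (starRingEnd ℂ) (mu proj x) = mu proj x := by
  simp [mu]

theorem innerG_single_mulVec_single {V : Type} [Fintype V] [DecidableEq V] {N : ℕ}
    (proj : V → Fin (N + 1)) (H : Matrix V V ℂ) (x y : V) :
    innerG proj (Pi.single x 1) (H.mulVec (Pi.single y 1)) =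
      (starRingEnd ℂ) (H x y * mu proj x) := by
  simp [innerG, Pi.single_apply, ite_mul, conj_mu]

theorem reduced_apply {V : Type} [Fintype V] {N : ℕ} (proj : V → Fin (N + 1))
    (H : Matrix V V ℂ) (J : Matrix (Fin (N + 1)) (Fin (N + 1)) ℂ)
    (hJ : ∀ φ, J.mulVec φ = avg proj (H.mulVec (lift proj φ))) (m n : Fin (N + 1)) :
    J m n = ∑ x ∈ layer proj m, ∑ y ∈ layer proj n, H x y * mu proj x := by
  have h := congrFun (hJ (Pi.single n 1)) m
  rw [Matrix.mulVec_single_one, Matrix.col_apply] at h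
  rw [h, avg, Finset.mul_sum]
  refine Finset.sum_congr rfl fun x hx => ?_
  have hx' : proj x = m := by simpa [layer] using hx
  rw [← Finset.sum_mul, mul_comm, mu, hx']
  congr 1
  simp [Matrix.mulVec, dotProduct, lift, Pi.single_apply, layer, Finset.sum_filter]

/-- Proposition 1, part 3: the Hamiltonian `H` is self-adjoint with
respect to the weighted inner product `⟨·,·⟩_G` on `ℂ^V` if and only if the reduced
operator `J = P ∘ H ∘ P*` is self-adjoint with respect to the standard inner product on
`ℂ^{0,…,N}`. -/
theorem hamiltonian_selfAdjoint_iff_reduced_selfAdjoint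
    (V : Type) [Fintype V] [DecidableEq V] [Nonempty V]
    (N : ℕ) (hN : 1 ≤ N)
    (proj : V → Fin (N + 1)) (hsurj : Function.Surjective proj)
    (Adj : V → V → Prop) [DecidableRel Adj]
    (hAdjSymm : Symmetric Adj) (hAdjIrrefl : Irreflexive Adj)
    (hlayeredge : ∀ x y, Adj x y →
      (proj y : ℕ) = (proj x : ℕ) + 1 ∨ (proj x : ℕ) = (proj y : ℕ) + 1)
    (hdegp : ∀ x y, proj x = proj y → degPlus proj Adj x = degPlus proj Adj y)
    (hdegm : ∀ x y, proj x = proj y → degMinus proj Adj x = degMinus proj Adj y)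
    (xL xR : V)
    (hxL : layer proj 0 = {xL})
    (hxR : layer proj (Fin.last N) = {xR})
    (H : Matrix V V ℂ)
    (hNN : ∀ x y, x ≠ y → ¬ Adj x y → H x y = 0)
    (hSymCoup : ∀ x₁ y₁ x₂ y₂, Adj x₁ y₁ → Adj x₂ y₂ →
      proj x₁ = proj x₂ → proj y₁ = proj y₂ →
      innerG proj (Pi.single x₁ 1) (H.mulVec (Pi.single y₁ 1)) =
        innerG proj (Pi.single x₂ 1) (H.mulVec (Pi.single y₂ 1)))
    (hDiag : ∀ x y, proj x = proj y →
      innerG proj (Pi.single x 1) (H.mulVec (Pi.single x 1)) =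
        innerG proj (Pi.single y 1) (H.mulVec (Pi.single y 1)))
    (J : Matrix (Fin (N + 1)) (Fin (N + 1)) ℂ)
    (hJ : ∀ φ, J.mulVec φ = avg proj (H.mulVec (lift proj φ))) :
    (∀ ψ χ : V → ℂ, innerG proj (H.mulVec ψ) χ = innerG proj ψ (H.mulVec χ)) ↔
    (∀ ψ χ : Fin (N + 1) → ℂ, innerStd (J.mulVec ψ) χ = innerStd ψ (J.mulVec χ)) := by
  have hG := weighted_selfAdjoint_iff H (mu proj)
  have hS := weighted_selfAdjoint_iff J (fun _ => 1)
  simp only [mul_one] at hS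
  simp only [innerG, innerStd]
  rw [hG, hS]
  have hdiff : ∀ m n, J m n - (starRingEnd ℂ) (J n m) =
      ∑ x ∈ layer proj m, ∑ y ∈ layer proj n,
        (H x y * mu proj x - (starRingEnd ℂ) (H y x) * mu proj y) := by
    intro m n
    simp only [reduced_apply proj H J hJ, Finset.sum_sub_distrib, map_sum, map_mul, conj_mu]
    congr 1
    exact Finset.sum_comm
  constructor
  · intro h m n
    rw [← sub_eq_zero, hdiff]
    exact Finset.sum_eq_zero fun x _ => Finset.sum_eq_zero fun y _ => sub_eq_zero.2 (h x y)
  · intro h x y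
    by_cases hxy : x = y ∨ Adj x y
    swap
    · push Not at hxy
      rw [hNN x y hxy.1 hxy.2, hNN y x hxy.1.symm fun h' => hxy.2 (hAdjSymm h')]
      simp
    have hK : ∀ x₁ y₁ x₂ y₂, (x₁ = y₁ ∨ Adj x₁ y₁) → (x₂ = y₂ ∨ Adj x₂ y₂) →
        proj x₁ = proj x₂ → proj y₁ = proj y₂ →
        H x₁ y₁ * mu proj x₁ = H x₂ y₂ * mu proj x₂ := by
      intro x₁ y₁ x₂ y₂ h₁ h₂ hx hy
      apply (starRingEnd ℂ).injective
      rw [← innerG_single_mulVec_single, ← innerG_single_mulVec_single]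
      rcases h₁ with rfl | h₁ <;> rcases h₂ with rfl | h₂
      · exact hDiag _ _ hx
      · have := hlayeredge _ _ h₂
        rw [← hx, ← hy] at this
        omega
      · have := hlayeredge _ _ h₁
        rw [hx, hy] at this
        omega
      · exact hSymCoup _ _ _ _ h₁ h₂ hx hy
    have hsymm : ∀ a b, (a = b ∨ Adj a b) → (b = a ∨ Adj b a) :=
      fun a b => Or.imp Eq.symm (fun h' => hAdjSymm h')
    have hsum := hdiff (proj x) (proj y)
    rw [sub_eq_zero.2 (h _ _), ← Finset.sum_product'] at hsum
    set S := (layer proj (proj x) ×ˢ layer proj (proj y)).filter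
      (fun p => p.1 = p.2 ∨ Adj p.1 p.2) with hSdef
    have hconst : ∑ p ∈ layer proj (proj x) ×ˢ layer proj (proj y),
        (H p.1 p.2 * mu proj p.1 - (starRingEnd ℂ) (H p.2 p.1) * mu proj p.2) =
        ∑ p ∈ S, (H x y * mu proj x - (starRingEnd ℂ) (H y x) * mu proj y) := by
      rw [hSdef, Finset.sum_filter]
      refine Finset.sum_congr rfl fun p hp => ?_
      obtain ⟨hp₁, hp₂⟩ : proj p.1 = proj x ∧ proj p.2 = proj y := by
        simpa [layer] using hp
      split_ifs with hc
      · have h₂ := congrArg (starRingEnd ℂ)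
          (hK _ _ _ _ (hsymm _ _ hc) (hsymm _ _ hxy) hp₂ hp₁)
        simp only [map_mul, conj_mu] at h₂
        rw [hK _ _ _ _ hc hxy hp₁ hp₂, h₂]
      · push Not at hc
        rw [hNN _ _ hc.1 hc.2, hNN _ _ hc.1.symm fun h' => hc.2 (hAdjSymm h')]
        simp
    rw [hconst, Finset.sum_const, nsmul_eq_mul] at hsum
    have hS0 : (S.card : ℂ) ≠ 0 := by
      refine Nat.cast_ne_zero.2 (Finset.card_ne_zero_of_mem (a := (x, y)) ?_)
      simp [hSdef, layer, hxy]
    exact sub_eq_zero.1 ((mul_eq_zero.1 hsum.symm).resolve_left hS0)
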